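/- Let f : (0,∞) → ℝ admit the representation f(t) = a + b·t + ∫₀^∞ (tλ)/(t+λ) dw(λ) for all t > 0, where a ∈ ℝ, b ≥ 0 and w is a positive measure on (0,∞) with ∫₀^∞ λ/(1+λ) dw(λ) < ∞. If A, B, P are strictly positive operators on a complex Hilbert space H with B ≥ A, then 𝒫_f(B,P) − 𝒫_f(A,P) ≥ b(B − A) ≥ 0. -/

import Mathlib

open MeasureTheory

variable {H : Type*} [NormedAddCommGroup H] [InnerProductSpace ℂ H] [CompleteSpace H]

/-- An operator `T` on a complex Hilbert space is *strictly positive* if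
`⟪T x, x⟫ ≥ 0` for all `x` and `T` is invertible. -/
def StrictlyPos (T : H →L[ℂ] H) : Prop := T.IsPositive ∧ IsUnit T

/-- `A^{1/2}` via the continuous functional calculus. -/
noncomputable def opSqrt (A : H →L[ℂ] H) : H →L[ℂ] H := cfc Real.sqrt A

/-- `A^{-1/2}` via the continuous functional calculus. -/
noncomputable def opInvSqrt (A : H →L[ℂ] H) : H →L[ℂ] H :=
  cfc (fun x : ℝ => (Real.sqrt x)⁻¹) A

/-- The noncommutative perspective `𝒫_f(B, A) := A^{1/2} f(A^{-1/2} B A^{-1/2}) A^{1/2}`. -/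
noncomputable def persp (f : ℝ → ℝ) (B A : H →L[ℂ] H) : H →L[ℂ] H :=
  opSqrt A * cfc f (opInvSqrt A * B * opInvSqrt A) * opSqrt A

/-- The weighted operator geometric mean `A ♯_ν B := A^{1/2} (A^{-1/2} B A^{-1/2})^ν A^{1/2}`. -/
noncomputable def gmean (ν : ℝ) (A B : H →L[ℂ] H) : H →L[ℂ] H :=
  opSqrt A * cfc (fun x : ℝ => x ^ ν) (opInvSqrt A * B * opInvSqrt A) * opSqrt A

/-- The relative operator entropy `S(A|B) := A^{1/2} ln(A^{-1/2} B A^{-1/2}) A^{1/2}`. -/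
noncomputable def relEntropy (A B : H →L[ℂ] H) : H →L[ℂ] H :=
  opSqrt A * cfc Real.log (opInvSqrt A * B * opInvSqrt A) * opSqrt A

section CStarAlgebra

variable {𝓐 : Type*} [CStarAlgebra 𝓐] [PartialOrder 𝓐] [StarOrderedRing 𝓐]

theorem cfc_mul_div_add_eq {l : ℝ} (hl : 0 < l) {C : 𝓐} (hC : IsStrictlyPositive C) :
    cfc (fun t : ℝ => t * l / (t + l)) C =
      algebraMap ℝ 𝓐 l - (l ^ 2) • Ring.inverse (C + algebraMap ℝ 𝓐 l) := by
  have hpos : ∀ t ∈ spectrum ℝ C, 0 < t := fun t ht => hC.spectrum_pos ht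
  have hsa : IsSelfAdjoint C := hC.isSelfAdjoint
  have hne : ∀ t ∈ spectrum ℝ C, t + l ≠ 0 := fun t ht => (add_pos (hpos t ht) hl).ne'
  have hadd : ContinuousOn (fun t : ℝ => t + l) (spectrum ℝ C) := by fun_prop
  have hinv : ContinuousOn (fun t : ℝ => (t + l)⁻¹) (spectrum ℝ C) := hadd.inv₀ hne
  have hcfc_inv :
      cfc (fun t : ℝ => (t + l)⁻¹) C = Ring.inverse (C + algebraMap ℝ 𝓐 l) := by
    rw [cfc_inv (fun t : ℝ => t + l) C hne hadd, cfc_add_const l (fun t : ℝ => t) C, cfc_id' ℝ C]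
  calc cfc (fun t : ℝ => t * l / (t + l)) C
      = cfc (fun t : ℝ => l - l ^ 2 * (t + l)⁻¹) C := by
        refine cfc_congr fun t ht => ?_
        have := hne t ht
        field_simp
        ring
    _ = _ := by
        rw [cfc_sub (fun _ : ℝ => l) (fun t : ℝ => l ^ 2 * (t + l)⁻¹) C
          continuousOn_const (hinv.const_mul _), cfc_const l C, cfc_const_mul (l ^ 2) _ C hinv,
          hcfc_inv]

theorem cfc_mul_div_add_mono {l : ℝ} (hl : 0 < l) {C D : 𝓐} (hC : IsStrictlyPositive C)
    (hCD : C ≤ D) :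
    cfc (fun t : ℝ => t * l / (t + l)) C ≤ cfc (fun t : ℝ => t * l / (t + l)) D := by
  have hl' : (0 : 𝓐) ≤ algebraMap ℝ 𝓐 l := algebraMap_nonneg 𝓐 hl.le
  rw [cfc_mul_div_add_eq hl hC, cfc_mul_div_add_eq hl (hC.of_le hCD)]
  refine sub_le_sub_left (smul_le_smul_of_nonneg_left ?_ (sq_nonneg l)) _
  exact CStarAlgebra.ringInverse_le_ringInverse (add_le_add_left hCD _) (hC.add_nonneg hl')

theorem continuousOn_uncurry_mul_div_add {C : 𝓐} (hC : IsStrictlyPositive C) :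
    ContinuousOn (Function.uncurry fun l t : ℝ => t * l / (t + l))
      (Set.Ioi 0 ×ˢ spectrum ℝ C) :=
  ContinuousOn.div (by fun_prop) (by fun_prop) fun p hp =>
    (add_pos (hC.spectrum_pos hp.2) hp.1).ne'

theorem ae_norm_mul_div_add_le (w : Measure ℝ) {C : 𝓐} (hC : IsStrictlyPositive C) :
    ∀ᵐ l ∂(w.restrict (Set.Ioi 0)), ∀ t ∈ spectrum ℝ C,
      ‖t * l / (t + l)‖ ≤ (1 + ‖C‖ * ‖(1 : 𝓐)‖) * (l / (1 + l)) := by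
  refine ae_restrict_of_forall_mem measurableSet_Ioi fun l (hl : 0 < l) t ht => ?_
  have htpos : 0 < t := hC.spectrum_pos ht
  have htle : t ≤ ‖C‖ * ‖(1 : 𝓐)‖ := (le_abs_self t).trans (spectrum.norm_le_norm_mul_of_mem ht)
  rw [Real.norm_of_nonneg (by positivity), ← mul_div_assoc, div_le_div_iff₀ (by positivity)
    (by positivity)]
  generalize ‖C‖ * ‖(1 : 𝓐)‖ = M at htle
  have h : t * (1 + l) ≤ (1 + M) * (t + l) := by nlinarith
  nlinarith

theorem integrableOn_cfc_mul_div_add {w : Measure ℝ}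
    (hw : IntegrableOn (fun l => l / (1 + l)) (Set.Ioi 0) w)
    {C : 𝓐} (hC : IsStrictlyPositive C) :
    IntegrableOn (fun l => cfc (fun t : ℝ => t * l / (t + l)) C) (Set.Ioi 0) w :=
  integrableOn_cfc measurableSet_Ioi _ _ C (continuousOn_uncurry_mul_div_add hC)
    (ae_norm_mul_div_add_le w hC) (hw.const_mul _).hasFiniteIntegral hC.isSelfAdjoint

theorem cfc_eq_add_setIntegral {f : ℝ → ℝ} {a b : ℝ} {w : Measure ℝ}
    (hf : ContinuousOn f (Set.Ioi 0))
    (hw : IntegrableOn (fun l => l / (1 + l)) (Set.Ioi 0) w)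
    (hrep : ∀ t > (0:ℝ), f t = a + b * t + ∫ l in Set.Ioi 0, t * l / (t + l) ∂w)
    {C : 𝓐} (hC : IsStrictlyPositive C) :
    cfc f C = algebraMap ℝ 𝓐 a + b • C +
      ∫ l in Set.Ioi 0, cfc (fun t : ℝ => t * l / (t + l)) C ∂w := by
  have hpos : ∀ t ∈ spectrum ℝ C, 0 < t := fun t ht => hC.spectrum_pos ht
  have hsa : IsSelfAdjoint C := hC.isSelfAdjoint
  have hint : ContinuousOn (fun t : ℝ => ∫ l in Set.Ioi 0, t * l / (t + l) ∂w)
      (spectrum ℝ C) := by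
    refine ContinuousOn.congr (f := fun t => f t - (a + b * t))
      ((hf.mono hpos).sub (by fun_prop)) fun t ht => ?_
    simp only [hrep t (hpos t ht), add_sub_cancel_left]
  rw [← cfc_setIntegral measurableSet_Ioi (fun l t : ℝ => t * l / (t + l)) _ C
    (continuousOn_uncurry_mul_div_add hC) (ae_norm_mul_div_add_le w hC)
    (hw.const_mul _).hasFiniteIntegral hsa, cfc_congr (fun t ht => hrep t (hpos t ht)),
    cfc_add C (fun t : ℝ => a + b * t) _ (by fun_prop) hint,
    cfc_const_add a (fun t : ℝ => b * t) C, cfc_const_mul_id b C]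

theorem smul_sub_le_cfc_sub_cfc {f : ℝ → ℝ} {a b : ℝ} {w : Measure ℝ}
    (hf : ContinuousOn f (Set.Ioi 0))
    (hw : IntegrableOn (fun l => l / (1 + l)) (Set.Ioi 0) w)
    (hrep : ∀ t > (0:ℝ), f t = a + b * t + ∫ l in Set.Ioi 0, t * l / (t + l) ∂w)
    {C D : 𝓐} (hC : IsStrictlyPositive C) (hCD : C ≤ D) :
    b • (D - C) ≤ cfc f D - cfc f C := by
  have hD := hC.of_le hCD
  have hmono : ∫ l in Set.Ioi 0, cfc (fun t : ℝ => t * l / (t + l)) C ∂w ≤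
      ∫ l in Set.Ioi 0, cfc (fun t : ℝ => t * l / (t + l)) D ∂w :=
    integral_mono_ae (integrableOn_cfc_mul_div_add hw hC) (integrableOn_cfc_mul_div_add hw hD)
      (ae_restrict_of_forall_mem measurableSet_Ioi fun l hl => cfc_mul_div_add_mono hl hC hCD)
  rw [cfc_eq_add_setIntegral hf hw hrep hC, cfc_eq_add_setIntegral hf hw hrep hD, smul_sub,
    ← sub_nonneg]
  convert sub_nonneg.mpr hmono using 1
  abel

end CStarAlgebra

theorem StrictlyPos.isStrictlyPositive {E : Type*} [NormedAddCommGroup E]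
    [InnerProductSpace ℂ E] {T : E →L[ℂ] E} (hT : StrictlyPos T) :
    IsStrictlyPositive T :=
  hT.2.isStrictlyPositive ((ContinuousLinearMap.nonneg_iff_isPositive T).mpr hT.1)

theorem continuousOn_inv_sqrt_spectrum {T : H →L[ℂ] H} (hT : IsStrictlyPositive T) :
    ContinuousOn (fun x : ℝ => (Real.sqrt x)⁻¹) (spectrum ℝ T) :=
  Real.continuous_sqrt.continuousOn.inv₀ fun _ hx =>
    (Real.sqrt_pos.mpr (hT.spectrum_pos hx)).ne'

theorem opSqrt_mul_opInvSqrt {T : H →L[ℂ] H} (hT : IsStrictlyPositive T) :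
    opSqrt T * opInvSqrt T = 1 := by
  have hsa : IsSelfAdjoint T := hT.isSelfAdjoint
  rw [opSqrt, opInvSqrt, ← cfc_mul _ _ T Real.continuous_sqrt.continuousOn
    (continuousOn_inv_sqrt_spectrum hT), ← cfc_one ℝ T]
  exact cfc_congr fun x hx => mul_inv_cancel₀ (Real.sqrt_pos.mpr (hT.spectrum_pos hx)).ne'

theorem opInvSqrt_mul_opSqrt {T : H →L[ℂ] H} (hT : IsStrictlyPositive T) :
    opInvSqrt T * opSqrt T = 1 :=
  (cfc_commute_cfc _ _ T).eq.trans (opSqrt_mul_opInvSqrt hT)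

/-- **Theorem 2.3, (2.16).** If `f(t) = a + b t + ∫₀^∞ tλ/(t+λ) dw(λ)` on `(0,∞)` and
`B ≥ A > 0`, `P > 0`, then `𝒫_f(B,P) - 𝒫_f(A,P) ≥ b(B - A) ≥ 0`. -/
theorem stmt_6 (f : ℝ → ℝ) (a b : ℝ) (hb : 0 ≤ b) (w : Measure ℝ)
    (hf : ContinuousOn f (Set.Ioi 0))
    (hw : IntegrableOn (fun l => l / (1 + l)) (Set.Ioi 0) w)
    (hrep : ∀ t > (0:ℝ), f t = a + b * t + ∫ l in Set.Ioi 0, t * l / (t + l) ∂w)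
    (A B P : H →L[ℂ] H) (hA : StrictlyPos A) (hB : StrictlyPos B) (hP : StrictlyPos P)
    (hBA : (B - A).IsPositive) :
    (persp f B P - persp f A P - b • (B - A)).IsPositive ∧ (b • (B - A)).IsPositive := by
  have hP' := hP.isStrictlyPositive
  have hA' := hA.isStrictlyPositive
  have hAB : A ≤ B := hBA
  have hSsa : IsSelfAdjoint (opSqrt P) := cfc_predicate _ P
  have hQsa : IsSelfAdjoint (opInvSqrt P) := cfc_predicate _ P
  have hSQ := opSqrt_mul_opInvSqrt hP'
  have hQS := opInvSqrt_mul_opSqrt hP'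
  have hQ : IsUnit (opInvSqrt P) := ⟨⟨_, _, hQS, hSQ⟩, rfl⟩
  have hC : IsStrictlyPositive (opInvSqrt P * A * opInvSqrt P) :=
    ((hQ.mul hA'.isUnit).mul hQ).isStrictlyPositive (hQsa.conjugate_nonneg hA'.nonneg)
  have hCD : opInvSqrt P * A * opInvSqrt P ≤ opInvSqrt P * B * opInvSqrt P :=
    hQsa.conjugate_le_conjugate hAB
  have key := hSsa.conjugate_le_conjugate (smul_sub_le_cfc_sub_cfc hf hw hrep hC hCD)
  have hcancel (T : H →L[ℂ] H) :
      opSqrt P * (opInvSqrt P * T * opInvSqrt P) * opSqrt P = T := by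
    simp only [mul_assoc, hQS, mul_one]
    rw [← mul_assoc, hSQ, one_mul]
  refine ⟨?_, (ContinuousLinearMap.nonneg_iff_isPositive _).mp
    (smul_nonneg hb (sub_nonneg.mpr hAB))⟩
  rw [← ContinuousLinearMap.le_def]
  rwa [mul_smul_comm, smul_mul_assoc, mul_sub, sub_mul, hcancel, hcancel, mul_sub, sub_mul] at key
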